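/- arXiv:1610.07081 — 5 statements merged into one kernel-verified Lean document; each statement's English description precedes it below -/
import Mathlib

section
/- Let a, b, c, d be positive real numbers with b ≤ d. Then the fixation probability of the frequency-dependent Moran process satisfies lim_{N→∞} ρ_A(N) = 0. -/
open Filter Finset Topology

/-- Fitness of strategy A in the frequency-dependent Moran process. -/
noncomputable def fA (a b : ℝ) (N : ℕ) (i : ℕ) : ℝ :=
  (a * ((i : ℝ) - 1) + b * ((N : ℝ) - (i : ℝ))) / ((N : ℝ) - 1)

/-- Fitness of strategy B in the frequency-dependent Moran process. -/
noncomputable def fB (c d : ℝ) (N : ℕ) (i : ℕ) : ℝ :=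
  (c * (i : ℝ) + d * ((N : ℝ) - (i : ℝ) - 1)) / ((N : ℝ) - 1)

/-- Fixation probability of strategy A in the frequency-dependent Moran process. -/
noncomputable def rhoA (a b c d : ℝ) (N : ℕ) : ℝ :=
  1 / (1 + ∑ k ∈ Icc 1 (N - 1), ∏ j ∈ Icc 1 k, fB c d N j / fA a b N j)

/-- Fixation probability of strategy B in the frequency-dependent Moran process. -/
noncomputable def rhoB (a b c d : ℝ) (N : ℕ) : ℝ :=
  1 / (1 + ∑ k ∈ Icc 1 (N - 1), ∏ j ∈ Icc 1 k, fA a b N (N - j) / fB c d N (N - j))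

lemma tendsto_aux (u v : ℝ) :
    Tendsto (fun N : ℕ => (u * ((N : ℝ) - 1) + v) / ((N : ℝ) - 1)) atTop (𝓝 u) := by
  have h1 : Tendsto (fun N : ℕ => (N : ℝ) - 1) atTop atTop :=
    tendsto_atTop_add_const_right _ (-1) tendsto_natCast_atTop_atTop
  have h2 : Tendsto (fun N : ℕ => u + v / ((N : ℝ) - 1)) atTop (𝓝 (u + 0)) :=
    tendsto_const_nhds.add (h1.const_div_atTop v)
  rw [add_zero] at h2
  refine h2.congr' ?_
  filter_upwards [h1.eventually_gt_atTop 0] with N hN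
  field_simp

/-- If b ≤ d, the fixation probability ρ_A vanishes in the large-population limit. -/
theorem rhoA_largeN_b_le_d (a b c d : ℝ) (ha : 0 < a) (hb : 0 < b) (hc : 0 < c)
    (hd : 0 < d) (hbd : b ≤ d) :
    Tendsto (fun N : ℕ => rhoA a b c d N) atTop (𝓝 0) := by
  have hA (j : ℕ) : Tendsto (fun N : ℕ => fA a b N j) atTop (𝓝 b) := by
    refine (tendsto_aux b ((a - b) * ((j : ℝ) - 1))).congr fun N => ?_
    unfold fA
    congr 1
    ring
  have hB (j : ℕ) : Tendsto (fun N : ℕ => fB c d N j) atTop (𝓝 d) := by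
    refine (tendsto_aux d ((c - d) * (j : ℝ))).congr fun N => ?_
    unfold fB
    congr 1
    ring
  have hS (K : ℕ) : Tendsto (fun N : ℕ => ∑ k ∈ Icc 1 K, ∏ j ∈ Icc 1 k, fB c d N j / fA a b N j)
      atTop (𝓝 (∑ k ∈ Icc 1 K, ∏ j ∈ Icc 1 k, d / b)) :=
    tendsto_finsetSum _ fun k _ => tendsto_finsetProd _ fun j _ => (hB j).div (hA j) hb.ne'
  have hK (K : ℕ) : (K : ℝ) ≤ ∑ k ∈ Icc 1 K, ∏ j ∈ Icc 1 k, d / b := by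
    have h1 : 1 ≤ d / b := (one_le_div hb).2 hbd
    calc (K : ℝ) = ∑ k ∈ Icc 1 K, (1 : ℝ) := by simp
      _ ≤ _ := by
        refine Finset.sum_le_sum fun k _ => ?_
        rw [Finset.prod_const]
        exact one_le_pow₀ h1
  have hT : Tendsto (fun N : ℕ => 1 + ∑ k ∈ Icc 1 (N - 1), ∏ j ∈ Icc 1 k, fB c d N j / fA a b N j)
      atTop atTop := by
    rw [tendsto_atTop]
    intro x
    obtain ⟨K, hxK⟩ := exists_nat_ge x
    have h2 : (K : ℝ) - 1 < ∑ k ∈ Icc 1 K, ∏ j ∈ Icc 1 k, d / b := by linarith [hK K]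
    filter_upwards [(hS K).eventually_const_lt h2, eventually_ge_atTop (K + 2)] with N hN hNK
    have h3 : ∑ k ∈ Icc 1 K, ∏ j ∈ Icc 1 k, fB c d N j / fA a b N j ≤
        ∑ k ∈ Icc 1 (N - 1), ∏ j ∈ Icc 1 k, fB c d N j / fA a b N j := by
      refine Finset.sum_le_sum_of_subset_of_nonneg (Finset.Icc_subset_Icc_right (by omega)) ?_
      intro k hk _
      refine Finset.prod_nonneg fun j hj => ?_
      rw [Finset.mem_Icc] at hk hj
      have hj1 : (1 : ℝ) ≤ j := by exact_mod_cast hj.1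
      have hj2 : (j : ℝ) + 1 ≤ N := by
        have : j + 1 ≤ N := by omega
        exact_mod_cast this
      have e1 : (0 : ℝ) ≤ (j : ℝ) - 1 := by linarith
      have e2 : (0 : ℝ) ≤ (N : ℝ) - j := by linarith
      have e3 : (0 : ℝ) ≤ (N : ℝ) - j - 1 := by linarith
      have e4 : (0 : ℝ) ≤ (N : ℝ) - 1 := by linarith
      unfold fA fB
      positivity
    linarith
  unfold rhoA
  exact hT.const_div_atTop 1
end

section
/- Let a, b, c, d be positive real numbers with b > d and a ≥ c. Then the fixation probability of the frequency-dependent Moran process satisfies lim_{N→∞} ρ_A(N) = (b − d)/b. -/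
open Filter Finset Topology

lemma ratio_eq (a b c d : ℝ) (N j : ℕ) (hN : 2 ≤ N) :
    fB c d N j / fA a b N j =
      (c * (j : ℝ) + d * ((N : ℝ) - (j : ℝ) - 1)) /
        (a * ((j : ℝ) - 1) + b * ((N : ℝ) - (j : ℝ))) := by
  have h : ((N : ℝ) - 1) ≠ 0 := by
    have : (2 : ℝ) ≤ N := by exact_mod_cast hN
    linarith
  unfold fA fB
  exact div_div_div_cancel_right₀ h _ _

lemma ratio_tendsto (a b c d : ℝ) (hb : 0 < b) (j : ℕ) :
    Tendsto (fun N : ℕ => fB c d N j / fA a b N j) atTop (𝓝 (d / b)) := by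
  have h1 := tendsto_const_div_atTop_nhds_zero_nat (c * (j : ℝ) - d * j - d)
  have h2 := tendsto_const_div_atTop_nhds_zero_nat (a * ((j : ℝ) - 1) - b * j)
  have h3 := (h1.const_add d).div (h2.const_add b) (by simpa using hb.ne')
  simp only [add_zero] at h3
  refine h3.congr' ?_
  filter_upwards [eventually_ge_atTop 2] with N hN
  have hN0 : (N : ℝ) ≠ 0 := by
    have : N ≠ 0 := by omega
    exact_mod_cast this
  rw [ratio_eq _ _ _ _ _ _ hN]
  simp only [Pi.div_apply]
  rw [← mul_div_mul_right _ _ hN0]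
  congr 1
  · field_simp; ring
  · field_simp; ring

lemma prod_bound (a b c d : ℝ) (ha : 0 < a) (hb : 0 < b) (hc : 0 < c)
    (hd : 0 < d) (hbd : d < b) (hac : c ≤ a) :
    ∃ M q : ℝ, 0 < q ∧ q < 1 ∧ ∀ᶠ N : ℕ in atTop, ∀ k < N,
      0 ≤ ∏ j ∈ Icc 1 k, fB c d N j / fA a b N j ∧
      ∏ j ∈ Icc 1 k, fB c d N j / fA a b N j ≤ M * q ^ (k / 2) := by
  have hbd' : 0 < b - d := sub_pos.2 hbd
  obtain ⟨K, hK⟩ := exists_nat_ge (c / (b - d))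
  rw [div_le_iff₀ hbd'] at hK
  obtain ⟨N0, hN0⟩ := exists_nat_ge (4 * c / (b - d))
  rw [div_le_iff₀ hbd'] at hN0
  obtain ⟨m, hm, hma, hmb⟩ : ∃ m : ℝ, 0 < m ∧ m ≤ a ∧ m ≤ b :=
    ⟨min a b, lt_min ha hb, min_le_left _ _, min_le_right _ _⟩
  set R : ℝ := 1 + c / m with hR
  have hcm : 0 < c / m := by positivity
  have hR1 : 1 ≤ R := by linarith
  set e : ℝ := (b - d) / (2 * (a + b)) with he
  have he0 : 0 < e := by positivity
  have he1 : e < 1 := by rw [he, div_lt_one (by positivity)]; linarith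
  have hee : e * (a + b) = (b - d) / 2 := by rw [he]; field_simp
  refine ⟨R ^ K, 1 - e, by linarith, by linarith, ?_⟩
  filter_upwards [eventually_ge_atTop 2, eventually_ge_atTop N0] with N hN hNN k hk
  have hNN' : (N0 : ℝ) ≤ N := by exact_mod_cast hNN
  have hN2 : (2 : ℝ) ≤ N := by exact_mod_cast hN
  have key : ∀ j ∈ Icc 1 k, 0 ≤ fB c d N j / fA a b N j ∧ fB c d N j / fA a b N j ≤
      (if 2 * j ≤ N then 1 - e else 1) * (if N < j + K then R else 1) := by
    intro j hj
    rw [Finset.mem_Icc] at hj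
    have hx : (0 : ℝ) ≤ (j : ℝ) - 1 := by
      have : (1 : ℝ) ≤ j := by exact_mod_cast hj.1
      linarith
    have hy : (1 : ℝ) ≤ (N : ℝ) - j := by
      have : (j : ℝ) + 1 ≤ N := by exact_mod_cast (by omega : j + 1 ≤ N)
      linarith
    rw [ratio_eq _ _ _ _ _ _ hN]
    have hnum : 0 ≤ c * (j : ℝ) + d * ((N : ℝ) - (j : ℝ) - 1) := by
      have : 0 ≤ (N : ℝ) - (j : ℝ) - 1 := by linarith
      positivity
    have hden : m ≤ a * ((j : ℝ) - 1) + b * ((N : ℝ) - (j : ℝ)) := by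
      nlinarith [mul_nonneg ha.le hx]
    have hden0 := hm.trans_le hden
    have hle : c * (j : ℝ) + d * ((N : ℝ) - (j : ℝ) - 1) ≤
        a * ((j : ℝ) - 1) + d * ((N : ℝ) - (j : ℝ)) + c := by
      nlinarith [mul_le_mul_of_nonneg_right hac hx]
    generalize hX : (j : ℝ) - 1 = x at *
    generalize hY : (N : ℝ) - (j : ℝ) = y at *
    refine ⟨div_nonneg hnum hden0.le, ?_⟩
    have b1 : (c * (j : ℝ) + d * (y - 1)) / (a * x + b * y) ≤ R := by
      rw [div_le_iff₀ hden0]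
      have : c ≤ c / m * (a * x + b * y) := by
        calc c = c / m * m := by field_simp
          _ ≤ _ := mul_le_mul_of_nonneg_left hden hcm.le
      have hdy : d * y ≤ b * y := mul_le_mul_of_nonneg_right hbd.le (by linarith)
      rw [hR, add_mul, one_mul]
      linarith
    have b2 : (K : ℝ) ≤ y → (c * (j : ℝ) + d * (y - 1)) / (a * x + b * y) ≤ 1 := by
      intro h
      rw [div_le_iff₀ hden0]
      have t3 := mul_le_mul_of_nonneg_right h hbd'.le
      linarith
    have b3 : 2 * j ≤ N → (c * (j : ℝ) + d * (y - 1)) / (a * x + b * y) ≤ 1 - e := by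
      intro h
      have h' : 2 * (j : ℝ) ≤ N := by exact_mod_cast h
      rw [div_le_iff₀ hden0]
      have hxy : x ≤ y := by linarith
      have hyN : (N : ℝ) / 2 ≤ y := by linarith
      have t1 : e * (a * x + b * y) ≤ e * (a + b) * y := by
        nlinarith [mul_le_mul_of_nonneg_left hxy (mul_pos he0 ha).le]
      rw [hee] at t1
      have t2 : 2 * c ≤ (b - d) * y := by
        have t3 := mul_le_mul_of_nonneg_right (hNN'.trans (by linarith : (N : ℝ) ≤ 2 * y)) hbd'.le
        linarith
      linarith
    split_ifs with h1 h2 h2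
    · exact (b3 h1).trans (le_mul_of_one_le_right (by linarith) hR1)
    · simpa using b3 h1
    · simpa using b1
    · have : ((j + K : ℕ) : ℝ) ≤ N := by exact_mod_cast not_lt.1 h2
      push_cast at this
      simpa using b2 (by linarith)
  refine ⟨Finset.prod_nonneg fun j hj => (key j hj).1, ?_⟩
  refine (Finset.prod_le_prod (fun j hj => (key j hj).1) (fun j hj => (key j hj).2)).trans ?_
  rw [Finset.prod_mul_distrib, Finset.prod_ite, Finset.prod_ite]
  simp only [Finset.prod_const, Finset.prod_const_one, mul_one, one_pow]
  rw [mul_comm]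
  have c1 : #{x ∈ Icc 1 k | N < x + K} ≤ K := by
    calc #{x ∈ Icc 1 k | N < x + K} ≤ #(Finset.Ioc (N - K) N) := by
          apply Finset.card_le_card
          intro x hx
          simp only [Finset.mem_filter, Finset.mem_Icc, Finset.mem_Ioc] at *
          omega
      _ ≤ K := by rw [Nat.card_Ioc]; omega
  have c2 : k / 2 ≤ #{x ∈ Icc 1 k | 2 * x ≤ N} := by
    calc k / 2 = #(Icc 1 (k / 2)) := by simp
      _ ≤ _ := by
          apply Finset.card_le_card
          intro x hx
          simp only [Finset.mem_filter, Finset.mem_Icc] at *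
          omega
  have q0 : 0 ≤ 1 - e := by linarith
  apply mul_le_mul
  · exact pow_le_pow_right₀ hR1 c1
  · exact pow_le_pow_of_le_one q0 (by linarith) c2
  · positivity
  · positivity

lemma summable_half (q : ℝ) (h0 : 0 < q) (h1 : q < 1) :
    Summable fun k : ℕ => q ^ (k / 2) := by
  have ht0 : 0 < √q := Real.sqrt_pos.2 h0
  have ht1 : √q < 1 := by rw [Real.sqrt_lt' one_pos]; simpa using h1
  refine Summable.of_nonneg_of_le (fun k => by positivity) (fun k => ?_)
    ((summable_geometric_of_lt_one ht0.le ht1).mul_left (1 / √q))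
  rw [one_div, inv_mul_eq_div, le_div_iff₀ ht0]
  calc q ^ (k / 2) * √q = √q ^ (2 * (k / 2) + 1) := by
        rw [pow_succ, pow_mul, Real.sq_sqrt h0.le]
    _ ≤ √q ^ k := pow_le_pow_of_le_one ht0.le ht1.le (by omega)

/-- If b > d and a ≥ c, then ρ_A → (b − d)/b as N → ∞. -/
theorem rhoA_largeN_b_gt_d_a_ge_c (a b c d : ℝ) (ha : 0 < a) (hb : 0 < b) (hc : 0 < c)
    (hd : 0 < d) (hbd : b > d) (hac : a ≥ c) :
    Tendsto (fun N : ℕ => rhoA a b c d N) atTop (𝓝 ((b - d) / b)) := by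
  obtain ⟨M, q, hq0, hq1, hM⟩ := prod_bound a b c d ha hb hc hd hbd hac
  have hlim : Tendsto (fun N : ℕ => ∑' k : ℕ,
      if k < N then ∏ j ∈ Icc 1 k, fB c d N j / fA a b N j else 0) atTop
      (𝓝 (∑' k : ℕ, (d / b) ^ k)) := by
    refine tendsto_tsum_of_dominated_convergence (bound := fun k => |M| * q ^ (k / 2))
      ((summable_half q hq0 hq1).mul_left |M|) ?_ ?_
    · intro k
      have h := tendsto_finsetProd (Icc 1 k) (fun j _ => ratio_tendsto a b c d hb j)
      simp only [Finset.prod_const, Nat.card_Icc, Nat.add_sub_cancel] at h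
      refine h.congr' ?_
      filter_upwards [eventually_gt_atTop k] with N hN
      rw [if_pos hN]
    · filter_upwards [hM] with N hN k
      have hq : 0 ≤ q ^ (k / 2) := by positivity
      split_ifs with h
      · rw [Real.norm_of_nonneg (hN k h).1]
        exact (hN k h).2.trans (mul_le_mul_of_nonneg_right (le_abs_self M) hq)
      · simp only [norm_zero]; positivity
  have hr : d / b < 1 := (div_lt_one hb).2 hbd
  rw [tsum_geometric_of_lt_one (by positivity) hr] at hlim
  have h2 := hlim.inv₀ (inv_ne_zero (by linarith))
  rw [inv_inv] at h2
  have hval : (b - d) / b = 1 - d / b := by field_simp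
  rw [hval]
  refine h2.congr' ?_
  filter_upwards [eventually_ge_atTop 1] with N hN
  unfold rhoA
  rw [one_div]
  congr 1
  rw [tsum_eq_sum (s := Finset.range N) (fun k hk => if_neg (by simpa using hk))]
  rw [Finset.sum_congr rfl (fun k hk => if_pos (Finset.mem_range.1 hk))]
  obtain ⟨n, rfl⟩ : ∃ n, N = n + 1 := ⟨N - 1, by omega⟩
  have : Finset.range (n + 1) = insert 0 (Icc 1 n) := by
    ext x; simp only [Finset.mem_range, Finset.mem_insert, Finset.mem_Icc]; omega
  rw [this, Finset.sum_insert (by simp)]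
  simp
end

section
/- Let a, b, c, d be positive real numbers with b > d, a < c, and I < 0, where I = ∫₀¹ ln((d + x(c−d))/(b + x(a−b))) dx. Then the fixation probability of the frequency-dependent Moran process satisfies lim_{N→∞} ρ_A(N) = (b − d)/b. -/
open Filter Finset Topology

/-- The ratio of fitnesses, with `N = M + 1` and index shifted by one. -/
noncomputable def rr (a b c d : ℝ) (M j : ℕ) : ℝ :=
  (d * M + (c - d) * (j + 1)) / (b * M + (a - b) * j)

lemma fB_div_fA (a b c d : ℝ) (M j : ℕ) (hM : 0 < M) :
    fB c d (M + 1) (j + 1) / fA a b (M + 1) (j + 1) = rr a b c d M j := by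
  have hM' : (M : ℝ) ≠ 0 := by positivity
  unfold fB fA rr
  push_cast
  rw [div_div_div_cancel_right₀ (by simpa using hM')]
  congr 1 <;> ring

lemma rhoA_succ (a b c d : ℝ) (M : ℕ) (hM : 0 < M) :
    rhoA a b c d (M + 1) = 1 / ∑ k ∈ range (M + 1), ∏ j ∈ range k, rr a b c d M j := by
  unfold rhoA
  have hp : ∀ k, ∏ j ∈ Icc 1 k, fB c d (M + 1) j / fA a b (M + 1) j
      = ∏ j ∈ range k, rr a b c d M j := by
    intro k
    rw [← Finset.Ico_add_one_right_eq_Icc, Finset.prod_Ico_eq_prod_range]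
    refine Finset.prod_congr (by simp) fun j _ => ?_
    rw [add_comm 1 j]
    exact fB_div_fA a b c d M j hM
  congr 1
  rw [Finset.sum_range_succ', add_comm]
  congr 1
  · rw [← Finset.Ico_add_one_right_eq_Icc, Finset.sum_Ico_eq_sum_range]
    refine Finset.sum_congr (by simp) fun j _ => ?_
    rw [add_comm 1 j, hp]

lemma avg_le (u : ℕ → ℝ) (k M : ℕ) (hk : k ≤ M)
    (hu : ∀ i j, i ≤ j → j < M → u i ≤ u j) :
    (M : ℝ) * ∑ j ∈ range k, u j ≤ k * ∑ j ∈ range M, u j := by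
  induction M, hk using Nat.le_induction with
  | base => exact le_rfl
  | succ n hn ih =>
    have h1 := ih fun i j hij hj => hu i j hij (by omega)
    have h2 : ∑ j ∈ range k, u j ≤ k * u n := by
      have := Finset.sum_le_card_nsmul (range k) u (u n) (fun i hi => by
        have := Finset.mem_range.1 hi
        exact hu i n (by omega) (by omega))
      simpa using this
    rw [Finset.sum_range_succ]
    push_cast
    linarith

lemma lin_pos {p q x : ℝ} (hp : 0 < p) (hq : 0 < q) (h0 : 0 ≤ x) (h1 : x ≤ 1) :
    0 < p + x * (q - p) := by
  have e : p + x * (q - p) = (1 - x) * p + x * q := by ring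
  rw [e]
  rcases h0.eq_or_lt with h | h
  · rw [← h]; simpa using hp
  · have := mul_nonneg (sub_nonneg.2 h1) hp.le
    have := mul_pos h hq
    linarith

lemma h_mono (a b c d : ℝ) (ha : 0 < a) (hb : 0 < b) (hc : 0 < c)
    (hd : 0 < d) (hbd : b > d) (hac : a < c) :
    MonotoneOn (fun x : ℝ => Real.log ((d + x * (c - d)) / (b + x * (a - b)))) (Set.Icc 0 1) := by
  intro x hx y hy hxy
  have h1 := lin_pos hd hc hx.1 hx.2
  have h2 := lin_pos hb ha hx.1 hx.2
  have h3 := lin_pos hb ha hy.1 hy.2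
  refine Real.log_le_log (div_pos h1 h2) ?_
  rw [div_le_div_iff₀ h2 h3]
  have : a * d < c * b := mul_lt_mul'' hac hbd ha.le hd.le
  nlinarith [mul_nonneg (sub_nonneg.2 hxy) (sub_nonneg.2 this.le)]

lemma rr_eq (a b c d : ℝ) (M j : ℕ) (hM : 0 < M) :
    rr a b c d M j = (d + ((j + 1 : ℕ) / (M : ℝ)) * (c - d)) / (b + (j / (M : ℝ)) * (a - b)) := by
  have hM' : (M : ℝ) ≠ 0 := by positivity
  unfold rr
  rw [← mul_div_mul_right (d + ((j + 1 : ℕ) / (M : ℝ)) * (c - d)) _ hM']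
  congr 1 <;> (push_cast; field_simp)

lemma frac_mem (M j : ℕ) (hj : j ≤ M) : 0 ≤ (j : ℝ) / M ∧ (j : ℝ) / M ≤ 1 :=
  ⟨by positivity, div_le_one_of_le₀ (by exact_mod_cast hj) (by positivity)⟩

lemma rr_pos (a b c d : ℝ) (ha : 0 < a) (hb : 0 < b) (hc : 0 < c)
    (hd : 0 < d) (M j : ℕ) (hj : j < M) : 0 < rr a b c d M j := by
  rw [rr_eq a b c d M j (by omega)]
  have h1 := frac_mem M j (by omega)
  have h2 := frac_mem M (j + 1) (by omega)
  exact div_pos (lin_pos hd hc h2.1 h2.2) (lin_pos hb ha h1.1 h1.2)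

lemma sum_log_le (a b c d : ℝ) (ha : 0 < a) (hb : 0 < b) (hc : 0 < c)
    (hd : 0 < d) (hbd : b > d) (hac : a < c) (M : ℕ) (hM : 0 < M) :
    ∑ j ∈ range M, Real.log (rr a b c d M j) ≤
      M * (∫ x in (0 : ℝ)..1, Real.log ((d + x * (c - d)) / (b + x * (a - b))))
        + (Real.log c - Real.log d) := by
  have hM' : (M : ℝ) ≠ 0 := by positivity
  set h : ℝ → ℝ := fun x => Real.log ((d + x * (c - d)) / (b + x * (a - b))) with hh
  have e : ∀ j ∈ range M, Real.log (rr a b c d M j) = h (j / M) +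
      (Real.log (d + ((j + 1 : ℕ) / (M : ℝ)) * (c - d))
        - Real.log (d + ((j : ℕ) / (M : ℝ)) * (c - d))) := by
    intro j hj
    have hj := Finset.mem_range.1 hj
    have h1 := frac_mem M j (by omega)
    have h2 := frac_mem M (j + 1) (by omega)
    have p1 := lin_pos hd hc h2.1 h2.2
    have p2 := lin_pos hb ha h1.1 h1.2
    have p3 := lin_pos hd hc h1.1 h1.2
    rw [rr_eq a b c d M j hM, hh]
    simp only
    rw [Real.log_div p1.ne' p2.ne', Real.log_div p3.ne' p2.ne']
    ring
  rw [Finset.sum_congr rfl e, Finset.sum_add_distrib,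
    Finset.sum_range_sub (fun j : ℕ => Real.log (d + ((j : ℕ) / (M : ℝ)) * (c - d)))]
  have hm : MonotoneOn (fun x : ℝ => h (x / M)) (Set.Icc 0 (0 + (M : ℕ))) := by
    intro x hx y hy hxy
    have hMp : (0 : ℝ) < M := by positivity
    rw [zero_add] at hx hy
    refine h_mono a b c d ha hb hc hd hbd hac ?_ ?_ ?_
    · exact ⟨div_nonneg hx.1 hMp.le, (div_le_one hMp).2 hx.2⟩
    · exact ⟨div_nonneg hy.1 hMp.le, (div_le_one hMp).2 hy.2⟩
    · gcongr
  have key := hm.sum_le_integral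
  simp only [zero_add] at key
  rw [intervalIntegral.integral_comp_div h hM', zero_div, div_self hM', smul_eq_mul] at key
  have e1 : d + ((M : ℕ) / (M : ℝ)) * (c - d) = c := by rw [div_self hM']; ring
  rw [e1]
  simp only [Nat.cast_zero, zero_div, zero_mul, add_zero]
  linarith

lemma rr_mono (a b c d : ℝ) (ha : 0 < a) (hb : 0 < b) (M : ℕ)
    (hM : (c - d) * (a - b) ≤ M * (b * c - a * d)) (hc : 0 < c) (hd : 0 < d)
    (i j : ℕ) (hij : i ≤ j) (hj : j < M) : rr a b c d M i ≤ rr a b c d M j := by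
  have hp : ∀ k < M, 0 < b * M + (a - b) * k := by
    intro k hk
    have h1 : (k : ℝ) < M := by exact_mod_cast hk
    have h2 : (0 : ℝ) ≤ k := by positivity
    nlinarith [mul_nonneg h2 ha.le, mul_pos (sub_pos.2 h1) hb]
  unfold rr
  rw [div_le_div_iff₀ (hp i (by omega)) (hp j hj)]
  have h1 : (i : ℝ) ≤ j := by exact_mod_cast hij
  nlinarith [mul_nonneg (sub_nonneg.2 h1) (sub_nonneg.2 hM)]

lemma rr_tendsto (a b c d : ℝ) (hb : 0 < b) (j : ℕ) :
    Tendsto (fun M : ℕ => rr a b c d M j) atTop (𝓝 (d / b)) := by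
  have h1 : Tendsto (fun M : ℕ => (d + ((j + 1 : ℕ) / (M : ℝ)) * (c - d)) /
      (b + (j / (M : ℝ)) * (a - b))) atTop (𝓝 ((d + 0 * (c - d)) / (b + 0 * (a - b)))) := by
    have t : ∀ x : ℝ, Tendsto (fun M : ℕ => x / (M : ℝ)) atTop (𝓝 0) :=
      fun x => tendsto_const_div_atTop_nhds_zero_nat x
    refine Tendsto.div ?_ ?_ (by simpa using hb.ne')
    · exact tendsto_const_nhds.add ((t _).mul_const _)
    · exact tendsto_const_nhds.add ((t _).mul_const _)
  simp only [zero_mul, add_zero] at h1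
  refine h1.congr' ?_
  filter_upwards [eventually_gt_atTop 0] with M hM
  exact (rr_eq a b c d M j hM).symm

/-- If b > d, a < c and I < 0, then ρ_A → (b − d)/b as N → ∞. -/
theorem rhoA_largeN_I_neg (a b c d : ℝ) (ha : 0 < a) (hb : 0 < b) (hc : 0 < c)
    (hd : 0 < d) (hbd : b > d) (hac : a < c)
    (hI : (∫ x in (0 : ℝ)..1, Real.log ((d + x * (c - d)) / (b + x * (a - b)))) < 0) :
    Tendsto (fun N : ℕ => rhoA a b c d N) atTop (𝓝 ((b - d) / b)) := by
  have hS := sum_log_le a b c d ha hb hc hd hbd hac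
  set I := ∫ x in (0 : ℝ)..1, Real.log ((d + x * (c - d)) / (b + x * (a - b))) with hIdef
  have hbc : 0 < b * c - a * d := by
    have : a * d < c * b := mul_lt_mul'' hac hbd ha.le hd.le
    linarith
  have ev1 : ∀ᶠ M : ℕ in atTop, (c - d) * (a - b) ≤ M * (b * c - a * d) :=
    (tendsto_natCast_atTop_atTop.atTop_mul_const hbc).eventually_ge_atTop _
  have ev2 : ∀ᶠ M : ℕ in atTop, Real.log c - Real.log d ≤ M * (-I / 2) :=
    (tendsto_natCast_atTop_atTop.atTop_mul_const (by linarith)).eventually_ge_atTop _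
  let F : ℕ → ℕ → ℝ := fun M k => if k ≤ M then ∏ j ∈ range k, rr a b c d M j else 0
  have hbound : ∀ᶠ M : ℕ in atTop, ∀ k, ‖F M k‖ ≤ Real.exp (I / 2) ^ k := by
    filter_upwards [ev1, ev2, eventually_gt_atTop 0] with M h1 h2 hM k
    have hMp : (0 : ℝ) < M := by positivity
    by_cases hk : k ≤ M
    · simp only [F, if_pos hk]
      have hpos : ∀ j ∈ range k, 0 < rr a b c d M j := fun j hj =>
        rr_pos a b c d ha hb hc hd M j (by have := Finset.mem_range.1 hj; omega)
      have hP := Finset.prod_pos hpos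
      rw [Real.norm_of_nonneg hP.le, ← Real.exp_nat_mul, ← Real.log_le_iff_le_exp hP,
        Real.log_prod (fun j hj => (hpos j hj).ne')]
      have hav := avg_le (fun j => Real.log (rr a b c d M j)) k M hk (fun i j hij hj =>
        Real.log_le_log (rr_pos a b c d ha hb hc hd M i (by omega))
          (rr_mono a b c d ha hb M h1 hc hd i j hij hj))
      have h3 : ∑ j ∈ range M, Real.log (rr a b c d M j) ≤ M * (I / 2) := by
        have := hS M hM
        linarith
      have h4 := mul_le_mul_of_nonneg_left h3 (Nat.cast_nonneg (α := ℝ) k)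
      refine le_of_mul_le_mul_left ?_ hMp
      calc _ ≤ _ := hav
        _ ≤ _ := h4
        _ = _ := by ring
    · simp only [F, if_neg hk, norm_zero]
      positivity
  have hsum : Summable fun k : ℕ => Real.exp (I / 2) ^ k :=
    summable_geometric_of_lt_one (Real.exp_pos _).le (Real.exp_lt_one_iff.2 (by linarith))
  have hlim : ∀ k, Tendsto (fun M => F M k) atTop (𝓝 ((d / b) ^ k)) := by
    intro k
    have h1 : Tendsto (fun M : ℕ => ∏ j ∈ range k, rr a b c d M j) atTop
        (𝓝 (∏ j ∈ range k, d / b)) := tendsto_finsetProd _ fun j _ => rr_tendsto a b c d hb j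
    rw [Finset.prod_const, Finset.card_range] at h1
    refine h1.congr' ?_
    filter_upwards [eventually_ge_atTop k] with M hM
    simp only [F, if_pos hM]
  have hT := tendsto_tsum_of_dominated_convergence hsum hlim hbound
  have hlt : d / b < 1 := (div_lt_one hb).2 hbd
  rw [tsum_geometric_of_lt_one (by positivity) hlt] at hT
  have hT2 := hT.inv₀ (inv_ne_zero (by linarith))
  rw [inv_inv] at hT2
  rw [← tendsto_add_atTop_iff_nat 1]
  have e : (b - d) / b = 1 - d / b := by field_simp
  rw [e]
  refine hT2.congr' ?_
  filter_upwards [eventually_gt_atTop 0] with M hM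
  rw [rhoA_succ a b c d M hM, one_div]
  congr 1
  rw [tsum_eq_sum (s := range (M + 1))]
  · refine Finset.sum_congr rfl fun k hk => ?_
    have := Finset.mem_range.1 hk
    simp only [F, if_pos (show k ≤ M by omega)]
  · intro k hk
    have : ¬ k ≤ M := by
      intro h
      exact hk (Finset.mem_range.2 (by omega))
    simp only [F, if_neg this]
end

section
/- Let a, b, c, d be positive real numbers with b > d, a < c, and I > 0, where I = ∫₀¹ ln((d + x(c−d))/(b + x(a−b))) dx. Then the fixation probability of the frequency-dependent Moran process satisfies lim_{N→∞} ρ_A(N) = 0. -/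
open Filter Finset Topology

lemma riemann_mono (f : ℝ → ℝ) (hf : MonotoneOn f (Set.Icc 0 1)) (M : ℕ) (hM : 0 < M) :
    |∑ i ∈ range M, f ((i : ℝ) / M) - M * ∫ x in (0:ℝ)..1, f x| ≤ |f 1 - f 0| := by
  have hM' : (0 : ℝ) < M := by exact_mod_cast hM
  have hm : MonotoneOn (fun x : ℝ => f (x / M)) (Set.Icc (0:ℝ) (0 + (M : ℝ))) := by
    intro x hx y hy hxy
    simp only [zero_add, Set.mem_Icc] at hx hy
    apply hf
    · exact ⟨div_nonneg hx.1 hM'.le, (div_le_one hM').2 hx.2⟩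
    · exact ⟨div_nonneg hy.1 hM'.le, (div_le_one hM').2 hy.2⟩
    · gcongr
  have h1 := hm.sum_le_integral
  have h2 := hm.integral_le_sum
  rw [intervalIntegral.integral_comp_div _ hM'.ne'] at h1 h2
  have e : (M : ℝ) / M = 1 := div_self hM'.ne'
  simp only [zero_add, zero_div, e, smul_eq_mul] at h1 h2
  have h3 := Finset.sum_range_sub (fun i : ℕ => f ((i : ℝ) / M)) M
  rw [Finset.sum_sub_distrib] at h3
  simp only [Nat.cast_zero, zero_div, e] at h3
  have h4 := le_abs_self (f 1 - f 0)
  rw [abs_le]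
  constructor <;> linarith [abs_nonneg (f 1 - f 0)]

lemma riemann_anti (f : ℝ → ℝ) (hf : AntitoneOn f (Set.Icc 0 1)) (M : ℕ) (hM : 0 < M) :
    |∑ i ∈ range M, f ((i : ℝ) / M) - M * ∫ x in (0:ℝ)..1, f x| ≤ |f 1 - f 0| := by
  have h := riemann_mono (fun x => - f x) hf.neg M hM
  rw [Finset.sum_neg_distrib, intervalIntegral.integral_neg] at h
  rw [← abs_neg, ← abs_neg (f 1 - f 0)]
  convert h using 2 <;> ring

lemma lin_pos_s10 (u v : ℝ) (hu : 0 < u) (hv : 0 < v) (x : ℝ) (hx : x ∈ Set.Icc (0:ℝ) 1) :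
    0 < u + x * (v - u) := by
  obtain ⟨h0, h1⟩ := hx
  rcases le_total u v with h | h
  · nlinarith [mul_nonneg h0 (sub_nonneg.2 h)]
  · nlinarith [mul_nonneg (sub_nonneg.2 h1) (sub_nonneg.2 h)]

lemma riemann_log (u v : ℝ) (hu : 0 < u) (hv : 0 < v) (M : ℕ) (hM : 0 < M) :
    |∑ i ∈ range M, Real.log (u + ((i : ℝ) / M) * (v - u))
      - M * ∫ x in (0:ℝ)..1, Real.log (u + x * (v - u))| ≤ |Real.log v - Real.log u| := by
  have key : |Real.log v - Real.log u| = |(fun x : ℝ => Real.log (u + x * (v - u))) 1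
      - (fun x : ℝ => Real.log (u + x * (v - u))) 0| := by simp
  rw [key]
  rcases le_total u v with h | h
  · apply riemann_mono (fun x : ℝ => Real.log (u + x * (v - u))) _ M hM
    intro x hx y hy hxy
    apply Real.log_le_log (lin_pos_s10 u v hu hv x hx)
    nlinarith
  · apply riemann_anti (fun x : ℝ => Real.log (u + x * (v - u))) _ M hM
    intro x hx y hy hxy
    apply Real.log_le_log (lin_pos_s10 u v hu hv y hy)
    nlinarith

lemma log_intble (u v : ℝ) (hu : 0 < u) (hv : 0 < v) :
    IntervalIntegrable (fun x : ℝ => Real.log (u + x * (v - u))) MeasureTheory.volume 0 1 := by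
  apply ContinuousOn.intervalIntegrable
  rw [Set.uIcc_of_le zero_le_one]
  apply ContinuousOn.log (by fun_prop)
  intro x hx
  exact (lin_pos_s10 u v hu hv x hx).ne'

lemma fB_eq (c d : ℝ) (M : ℕ) (hM : 0 < M) (i : ℕ) :
    fB c d (M + 1) (i + 1) = d + (((i + 1 : ℕ) : ℝ) / M) * (c - d) := by
  have hM' : (M : ℝ) ≠ 0 := by exact_mod_cast hM.ne'
  unfold fB
  push_cast
  rw [add_sub_cancel_right]
  field_simp
  ring

lemma fA_eq (a b : ℝ) (M : ℕ) (hM : 0 < M) (i : ℕ) :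
    fA a b (M + 1) (i + 1) = b + ((i : ℝ) / M) * (a - b) := by
  have hM' : (M : ℝ) ≠ 0 := by exact_mod_cast hM.ne'
  unfold fA
  push_cast
  rw [add_sub_cancel_right, add_sub_cancel_right]
  field_simp
  ring

lemma frac_mem_s10 (M i : ℕ) (hM : 0 < M) (hi : i ≤ M) : (i : ℝ) / M ∈ Set.Icc (0:ℝ) 1 := by
  have hM' : (0 : ℝ) < M := by exact_mod_cast hM
  exact ⟨by positivity, (div_le_one hM').2 (by exact_mod_cast hi)⟩

lemma sum_lower (a b c d : ℝ) (ha : 0 < a) (hb : 0 < b) (hc : 0 < c) (hd : 0 < d)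
    (M : ℕ) (hM : 0 < M) :
    M * (∫ x in (0 : ℝ)..1, Real.log ((d + x * (c - d)) / (b + x * (a - b))))
      + (-(2 * |Real.log c - Real.log d|) - |Real.log a - Real.log b|) ≤
    1 + ∑ k ∈ Icc 1 (M + 1 - 1), ∏ j ∈ Icc 1 k, fB c d (M + 1) j / fA a b (M + 1) j := by
  have hM' : (M : ℝ) ≠ 0 := by exact_mod_cast hM.ne'
  have posB : ∀ i < M, 0 < fB c d (M + 1) (i + 1) := fun i hi => by
    rw [fB_eq c d M hM]; exact lin_pos_s10 d c hd hc _ (frac_mem_s10 M _ hM hi)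
  have posA : ∀ i < M, 0 < fA a b (M + 1) (i + 1) := fun i hi => by
    rw [fA_eq a b M hM]; exact lin_pos_s10 b a hb ha _ (frac_mem_s10 M _ hM hi.le)
  rw [Nat.add_sub_cancel]
  have hpos : ∀ k ∈ Icc 1 M, 0 < ∏ j ∈ Icc 1 k, fB c d (M + 1) j / fA a b (M + 1) j := by
    intro k hk
    apply Finset.prod_pos
    intro j hj
    rw [Finset.mem_Icc] at hk hj
    obtain ⟨i, rfl⟩ : ∃ i, j = i + 1 := ⟨j - 1, by omega⟩
    exact div_pos (posB i (by omega)) (posA i (by omega))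
  have hmem : M ∈ Icc 1 M := by rw [Finset.mem_Icc]; omega
  have h1 := Finset.single_le_sum (fun k hk => (hpos k hk).le) hmem
  have h2 := Real.log_le_sub_one_of_pos (hpos M hmem)
  have h3 : Real.log (∏ j ∈ Icc 1 M, fB c d (M + 1) j / fA a b (M + 1) j) =
      ∑ i ∈ range M, Real.log (d + (((i + 1 : ℕ) : ℝ) / M) * (c - d))
      - ∑ i ∈ range M, Real.log (b + ((i : ℝ) / M) * (a - b)) := by
    have : ∏ j ∈ Icc 1 M, fB c d (M + 1) j / fA a b (M + 1) j
        = ∏ i ∈ range M, fB c d (M + 1) (i + 1) / fA a b (M + 1) (i + 1) := by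
      rw [Finset.range_eq_Ico, Finset.prod_Ico_add' (fun j => fB c d (M + 1) j / fA a b (M + 1) j)]
      rfl
    rw [this, Real.log_prod, ← Finset.sum_sub_distrib]
    · apply Finset.sum_congr rfl
      intro i hi
      rw [Finset.mem_range] at hi
      rw [Real.log_div (posB i hi).ne' (posA i hi).ne', fA_eq a b M hM, fB_eq c d M hM]
    · intro i hi
      rw [Finset.mem_range] at hi
      exact (div_pos (posB i hi) (posA i hi)).ne'
  have h4 : ∫ x in (0 : ℝ)..1, Real.log ((d + x * (c - d)) / (b + x * (a - b))) =
      (∫ x in (0 : ℝ)..1, Real.log (d + x * (c - d)))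
      - ∫ x in (0 : ℝ)..1, Real.log (b + x * (a - b)) := by
    rw [← intervalIntegral.integral_sub (log_intble d c hd hc) (log_intble b a hb ha)]
    apply intervalIntegral.integral_congr
    intro x hx
    rw [Set.uIcc_of_le zero_le_one] at hx
    exact Real.log_div (lin_pos_s10 d c hd hc x hx).ne' (lin_pos_s10 b a hb ha x hx).ne'
  have h5 := Finset.sum_range_sub (fun i : ℕ => Real.log (d + ((i : ℝ) / M) * (c - d))) M
  rw [Finset.sum_sub_distrib, div_self hM'] at h5
  simp only [Nat.cast_zero, zero_div, zero_mul, add_zero, one_mul, add_sub_cancel] at h5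
  have h6 := abs_le.1 (riemann_log d c hd hc M hM)
  have h7 := abs_le.1 (riemann_log b a hb ha M hM)
  have h8 := neg_abs_le (Real.log c - Real.log d)
  rw [h4, mul_sub]
  linarith [h6.1, h7.2]

/-- If b > d, a < c and I > 0, then ρ_A → 0 as N → ∞. -/
theorem rhoA_largeN_I_pos (a b c d : ℝ) (ha : 0 < a) (hb : 0 < b) (hc : 0 < c)
    (hd : 0 < d) (hbd : b > d) (hac : a < c)
    (hI : 0 < ∫ x in (0 : ℝ)..1, Real.log ((d + x * (c - d)) / (b + x * (a - b)))) :
    Tendsto (fun N : ℕ => rhoA a b c d N) atTop (𝓝 0) := by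
  rw [← tendsto_add_atTop_iff_nat 1]
  unfold rhoA
  simp only [one_div]
  apply Tendsto.inv_tendsto_atTop
  refine tendsto_atTop_mono' atTop ?_ (tendsto_atTop_add_const_right atTop
    (-(2 * |Real.log c - Real.log d|) - |Real.log a - Real.log b|)
    (tendsto_natCast_atTop_atTop.atTop_mul_const hI))
  filter_upwards [eventually_gt_atTop 0] with M hM
  exact sum_lower a b c d ha hb hc hd M hM
end

section
/- Let a, b, c, d be positive real numbers with b > d, a < c, and I = 0, where I = ∫₀¹ ln((d + x(c−d))/(b + x(a−b))) dx. Then lim_{N→∞} Π_{i=1}^{N−1} f_B(i)/f_A(i) = √(ac/(bd)), where f_A(i) = (a(i−1)+b(N−i))/(N−1) and f_B(i) = (ci+d(N−i−1))/(N−1). -/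
open Filter Finset Topology

theorem trap_bound (f : ℝ → ℝ) (hf : ContDiffOn ℝ 2 f (Set.uIcc 0 1)) :
    Tendsto (fun n : ℕ => ((n : ℝ) + 1) * trapezoidal_error f (n + 1) 0 1) atTop (𝓝 0) := by
  have hu : UniqueDiffOn ℝ (Set.uIcc (0 : ℝ) 1) := uniqueDiffOn_uIcc zero_ne_one
  have hcont : ContinuousOn (iteratedDerivWithin 2 f (Set.uIcc 0 1)) (Set.uIcc 0 1) :=
    hf.continuousOn_iteratedDerivWithin (by norm_cast) hu
  obtain ⟨C, hC⟩ := isCompact_uIcc.exists_bound_of_continuousOn hcont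
  have hb : ∀ x, |iteratedDerivWithin 2 f (Set.uIcc 0 1) x| ≤ max C 0 := by
    intro x
    by_cases hx : x ∈ Set.uIcc (0 : ℝ) 1
    · exact (hC x hx).trans (le_max_left _ _)
    · rw [iteratedDerivWithin_succ, derivWithin_zero_of_notMem_closure
        (by rwa [isCompact_uIcc.isClosed.closure_eq]), abs_zero]
      exact le_max_right _ _
  have hlim : Tendsto (fun n : ℕ => (max C 0 / 12) * (1 / ((n : ℝ) + 1))) atTop (𝓝 0) := by
    simpa using tendsto_one_div_add_atTop_nhds_zero_nat.const_mul (max C 0 / 12)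
  refine squeeze_zero_norm (fun n => ?_) hlim
  have h := trapezoidal_error_le_of_c2 hf hb (Nat.succ_pos n)
  have hn : (0 : ℝ) < (n : ℝ) + 1 := by positivity
  rw [norm_mul, Real.norm_eq_abs, Real.norm_eq_abs, abs_of_pos hn]
  calc ((n : ℝ) + 1) * |trapezoidal_error f (n + 1) 0 1|
      ≤ ((n : ℝ) + 1) * (|1 - 0| ^ 3 * max C 0 / (12 * ((n + 1 : ℕ) : ℝ) ^ 2)) := by gcongr
    _ = (max C 0 / 12) * (1 / ((n : ℝ) + 1)) := by
      push_cast
      simp only [sub_zero, abs_one]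
      field_simp

theorem aff_pos (p q x : ℝ) (hp : 0 < p) (hq : 0 < q) (h0 : 0 ≤ x) (h1 : x ≤ 1) :
    0 < p + x * (q - p) := by
  rcases eq_or_lt_of_le h0 with h | h
  · simp [← h, hp]
  · nlinarith [mul_pos h hq, mul_nonneg (sub_nonneg.2 h1) hp.le]

/-- If b > d, a < c and I = 0, then Π_{i=1}^{N−1} f_B(i)/f_A(i) → √(ac/(bd)) as N → ∞. -/
theorem prod_ratio_largeN_I_zero (a b c d : ℝ) (ha : 0 < a) (hb : 0 < b) (hc : 0 < c)
    (hd : 0 < d) (hbd : b > d) (hac : a < c)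
    (hI : (∫ x in (0 : ℝ)..1, Real.log ((d + x * (c - d)) / (b + x * (a - b)))) = 0) :
    Tendsto (fun N : ℕ => ∏ i ∈ Icc 1 (N - 1), fB c d N i / fA a b N i) atTop
      (𝓝 (Real.sqrt (a * c / (b * d)))) := by
  set f : ℝ → ℝ := fun x => Real.log ((d + x * (c - d)) / (b + x * (a - b))) with hfdef
  have hf : ContDiffOn ℝ 2 f (Set.uIcc 0 1) := by
    intro x hx
    rw [Set.uIcc_of_le zero_le_one] at hx
    have h1 := aff_pos d c x hd hc hx.1 hx.2
    have h2 := aff_pos b a x hb ha hx.1 hx.2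
    apply ContDiffAt.contDiffWithinAt
    apply ContDiffAt.log
    · apply ContDiffAt.div
      · fun_prop
      · fun_prop
      · exact h2.ne'
    · exact (div_pos h1 h2).ne'
  have hlim := trap_bound f hf
  rw [← tendsto_add_atTop_iff_nat 2]
  have key : ∀ n : ℕ, ∏ i ∈ Icc 1 (n + 2 - 1), fB c d (n + 2) i / fA a b (n + 2) i =
      Real.exp (((n : ℝ) + 1) * trapezoidal_error f (n + 1) 0 1) *
        Real.sqrt (a * c / (b * d)) := by
    intro n
    have hn : (0 : ℝ) < (n : ℝ) + 1 := by positivity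
    have hS : ((n : ℝ) + 1) * trapezoidal_error f (n + 1) 0 1 =
        (f 0 + f 1) / 2 + ∑ k ∈ range n, f (((k : ℝ) + 1) / ((n : ℝ) + 1)) := by
      rw [trapezoidal_error, hI, trapezoidal_integral]
      simp only [Nat.add_sub_cancel, sub_zero, zero_add, mul_one]
      push_cast
      field_simp
    have hP : ∏ i ∈ Icc 1 (n + 2 - 1), fB c d (n + 2) i / fA a b (n + 2) i =
        (∏ k ∈ range n, Real.exp (f (((k : ℝ) + 1) / ((n : ℝ) + 1)))) * (c / b) := by
      have e1 : ∏ i ∈ Icc 1 (n + 2 - 1), fB c d (n + 2) i / fA a b (n + 2) i =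
          ∏ k ∈ range (n + 1), fB c d (n + 2) (k + 1) / fA a b (n + 2) (k + 1) := by
        rw [show n + 2 - 1 = n + 1 by omega, ← Finset.Ico_add_one_right_eq_Icc,
          Finset.prod_Ico_eq_prod_range]
        simp [add_comm]
      rw [e1, Finset.prod_div_distrib, Finset.prod_range_succ, Finset.prod_range_succ',
        mul_div_mul_comm, ← Finset.prod_div_distrib]
      congr 1
      · apply Finset.prod_congr rfl
        intro k hk
        have hk' : (k : ℝ) + 1 ≤ (n : ℝ) := by exact_mod_cast Finset.mem_range.1 hk
        have x0 : 0 ≤ ((k : ℝ) + 1) / ((n : ℝ) + 1) := by positivity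
        have x1 : ((k : ℝ) + 1) / ((n : ℝ) + 1) ≤ 1 := by
          rw [div_le_one hn]; linarith
        have h1 := aff_pos d c _ hd hc x0 x1
        have h2 := aff_pos b a _ hb ha x0 x1
        rw [hfdef]
        simp only
        rw [Real.exp_log (div_pos h1 h2)]
        have hn' : (n : ℝ) + 2 - 1 = n + 1 := by ring
        congr 1
        · simp only [fB]; push_cast; rw [hn']; field_simp; ring
        · simp only [fA]; push_cast; rw [hn']; field_simp; ring
      · have hn' : (n : ℝ) + 2 - 1 = n + 1 := by ring
        congr 1
        · simp only [fB]; push_cast; rw [hn']; field_simp; ring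
        · simp only [fA]; push_cast; rw [hn']; field_simp; ring
    have h3 : Real.exp ((f 0 + f 1) / 2) * Real.sqrt (a * c / (b * d)) = c / b := by
      have e0 : f 0 + f 1 = Real.log (d / b * (c / a)) := by
        rw [Real.log_mul (by positivity) (by positivity)]
        simp [hfdef]
      rw [e0, Real.exp_half, Real.exp_log (by positivity), ← Real.sqrt_mul (by positivity),
        show d / b * (c / a) * (a * c / (b * d)) = (c / b) ^ 2 by field_simp,
        Real.sqrt_sq (by positivity)]
    rw [hP, hS, Real.exp_add, Real.exp_sum, ← h3]
    ring
  simp_rw [key]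
  simpa using ((Real.continuous_exp.tendsto 0).comp hlim).mul_const (Real.sqrt (a * c / (b * d)))
end
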